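/- arXiv:2602.15977 — 7 statements merged into one kernel-verified Lean document; each statement's English description precedes it below -/
import Mathlib

section
/- Let T be a rooted tree on n nodes. Then the number of linear extensions of the tree order satisfies |LE(T)| = n! · ∏_{v ∈ V(T)} 1/|T_v|; equivalently, |LE(T)| · ∏_{v ∈ V(T)} |T_v| = n! (Knuth's hook-length formula for trees). -/
/-- A rooted tree on a node set `α`, given by its root and parent function
(the root is its own parent, and every node reaches the root by iterating `parent`). -/
structure RTree (α : Type*) where
  root : α
  parent : α → α
  parent_root : parent root = root
  reaches_root : ∀ v, ∃ k, parent^[k] v = root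

namespace RTree

variable {α : Type*}

/-- `u` is a (weak) ancestor of `v` in `T`. -/
def ancestor (T : RTree α) (u v : α) : Prop := ∃ k, T.parent^[k] v = u

/-- `u` is a proper ancestor of `v` in `T`. -/
def properAncestor (T : RTree α) (u v : α) : Prop := T.ancestor u v ∧ u ≠ v

/-- The node set of the subtree `T_v` of `T` rooted at `v`,
i.e. `v` together with all of its descendants. -/
def subtree (T : RTree α) (v : α) : Set α := {u | T.ancestor v u}

/-- A leaf of `T` is a node with no children. -/
def IsLeaf (T : RTree α) (v : α) : Prop := ∀ u, T.parent u = v → u = v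

end RTree

/-- The set of linear extensions of the tree order of `T`: orderings of the nodes
in which every node appears before all of its proper ancestors. -/
def linExts {α : Type*} [Fintype α] (T : RTree α) : Set (α ≃ Fin (Fintype.card α)) :=
  {f | ∀ u v : α, T.properAncestor u v → f v < f u}

namespace RTree

variable {α : Type*} (T : RTree α)

theorem ancestor_refl (v : α) : T.ancestor v v := ⟨0, rfl⟩

variable {T}

theorem ancestor.trans {u v w : α} (huv : T.ancestor u v) (hvw : T.ancestor v w) :
    T.ancestor u w := by
  obtain ⟨a, rfl⟩ := hvw
  obtain ⟨b, rfl⟩ := huv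
  exact ⟨b + a, Function.iterate_add_apply _ _ _ _⟩

theorem iterate_parent_root (k : ℕ) : T.parent^[k] T.root = T.root :=
  Function.iterate_fixed T.parent_root k

theorem eq_root_of_iterate_parent_eq {v : α} {c : ℕ} (hc : 0 < c) (h : T.parent^[c] v = v) :
    v = T.root := by
  obtain ⟨k, hk⟩ := T.reaches_root v
  have hfix : T.parent^[c * k] v = v := by
    rw [Function.iterate_mul]
    exact Function.iterate_fixed h k
  rw [← hfix, ← Nat.sub_add_cancel (Nat.le_mul_of_pos_left k hc), Function.iterate_add_apply, hk,
    iterate_parent_root]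

theorem ancestor.antisymm {u v : α} (huv : T.ancestor u v) (hvu : T.ancestor v u) : u = v := by
  obtain ⟨a, rfl⟩ := huv
  obtain ⟨b, hb⟩ := hvu
  rcases Nat.eq_zero_or_pos a with rfl | ha
  · rfl
  · rw [← Function.iterate_add_apply] at hb
    rw [eq_root_of_iterate_parent_eq (by omega) hb, iterate_parent_root]

theorem ancestor.total {s w u : α} (hs : T.ancestor s u) (hw : T.ancestor w u) :
    T.ancestor s w ∨ T.ancestor w s := by
  obtain ⟨a, rfl⟩ := hs
  obtain ⟨b, rfl⟩ := hw
  rcases le_total a b with h | h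
  · exact Or.inr ⟨b - a, by rw [← Function.iterate_add_apply, Nat.sub_add_cancel h]⟩
  · exact Or.inl ⟨a - b, by rw [← Function.iterate_add_apply, Nat.sub_add_cancel h]⟩

theorem subtree_ssubset_of_ancestor {w v : α} (h : T.ancestor w v) (hne : w ≠ v) :
    T.subtree v ⊂ T.subtree w :=
  ⟨fun _ hu => h.trans hu, fun hsub => hne (h.antisymm (hsub (T.ancestor_refl w)))⟩

variable (T) in
/-- `S` contains all ancestors of its elements. -/
def AncestorClosed (S : Finset α) : Prop := ∀ v ∈ S, ∀ u, T.ancestor u v → u ∈ S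

variable (T) in
/-- `f` attains its maximum over the subtree rooted at `v` at the node `u`. -/
def IsTop {β : Type*} [LE β] (f : α → β) (v u : α) : Prop := ∀ x, T.ancestor v x → f x ≤ f u

theorem AncestorClosed.exists_erase [Finite α] [DecidableEq α] {S : Finset α}
    (hS : T.AncestorClosed S) (hne : S.Nonempty) :
    ∃ w ∈ S, T.AncestorClosed (S.erase w) := by
  obtain ⟨w, hw, hmin⟩ := S.exists_min_image (fun v => (T.subtree v).ncard) hne
  refine ⟨w, hw, fun v hv u huv => ?_⟩
  obtain ⟨hvw, hvS⟩ := Finset.mem_erase.mp hv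
  refine Finset.mem_erase.mpr ⟨?_, hS v hvS u huv⟩
  rintro rfl
  exact (hmin v hvS).not_gt
    (Set.ncard_lt_ncard (subtree_ssubset_of_ancestor huv hvw.symm) (Set.toFinite _))

theorem ancestor_swap_iff [DecidableEq α] {s w u : α} (hws : ¬ T.ancestor w s)
    (hu : T.ancestor w u) (x : α) :
    T.ancestor s (Equiv.swap w u x) ↔ T.ancestor s x := by
  have key : T.ancestor s w ↔ T.ancestor s u :=
    ⟨fun h => h.trans hu, fun h => (h.total hu).resolve_right hws⟩
  rw [Equiv.swap_apply_def]
  split_ifs with h₁ h₂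
  · rw [h₁, key]
  · rw [h₂, key]
  · rfl

theorem isTop_swap [DecidableEq α] {β : Type*} [LE β] {f : α → β} {s w u : α}
    (hws : ¬ T.ancestor w s) (hu : T.ancestor w u) (hf : T.IsTop f s s) :
    T.IsTop (f ∘ Equiv.swap w u) s s := by
  intro x hx
  have hsw : s ≠ w := fun h => hws (h ▸ T.ancestor_refl w)
  have hsu : s ≠ u := fun h => hws (h ▸ hu)
  simpa [Equiv.swap_apply_of_ne_of_ne hsw hsu] using hf _ ((ancestor_swap_iff hws hu x).2 hx)

theorem isTop_comp_swap_iff [DecidableEq α] {β : Type*} [LE β] {f : α → β} {w u v : α}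
    (hu : T.ancestor w u) :
    T.IsTop (f ∘ Equiv.swap w u) w v ↔ T.IsTop f w (Equiv.swap w u v) := by
  have hmem : ∀ x, T.ancestor w x → T.ancestor w (Equiv.swap w u x) := by
    intro x hx
    rw [Equiv.swap_apply_def]
    split_ifs
    exacts [hu, T.ancestor_refl w, hx]
  refine ⟨fun h x hx => ?_, fun h x hx => h _ (hmem x hx)⟩
  simpa using h _ (hmem x hx)

open Classical in
variable (T) in
/-- The orderings of the nodes in which every `v ∈ S` comes last in its subtree. -/
noncomputable def partialExts [Fintype α] (S : Finset α) :
    Finset (α ≃ Fin (Fintype.card α)) :=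
  {f | ∀ v ∈ S, T.IsTop f v v}

theorem mem_partialExts [Fintype α] {S : Finset α} {f : α ≃ Fin (Fintype.card α)} :
    f ∈ T.partialExts S ↔ ∀ v ∈ S, T.IsTop f v v := by
  simp [partialExts]

theorem swap_trans_mem_partialExts [Fintype α] [DecidableEq α] {S : Finset α} {w u : α}
    (hS : T.AncestorClosed S) (hw : w ∉ S) (hu : T.ancestor w u)
    {f : α ≃ Fin (Fintype.card α)} (hf : f ∈ T.partialExts S) :
    (Equiv.swap w u).trans f ∈ T.partialExts S :=
  mem_partialExts.2 fun s hs =>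
    isTop_swap (fun h => hw (hS s hs w h)) hu (mem_partialExts.1 hf s hs)

theorem card_partialExts_insert [Fintype α] [DecidableEq α] {S : Finset α} {w : α}
    (hS : T.AncestorClosed S) (hw : w ∉ S) :
    (T.partialExts (insert w S)).card * (T.subtree w).ncard = (T.partialExts S).card := by
  classical
  have hmem : ∀ u, u ∈ (T.subtree w).toFinset ↔ T.ancestor w u := fun _ => Set.mem_toFinset
  have hcount := Finset.card_mul_eq_card_mul (s := T.partialExts S)
    (t := (T.subtree w).toFinset) (m := 1) (n := (T.partialExts (insert w S)).card)
    (fun (f : α ≃ Fin (Fintype.card α)) u => T.IsTop f w u) ?_ ?_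
  · rw [Set.ncard_eq_toFinset_card', mul_comm, ← hcount, mul_one]
  · intro f _
    obtain ⟨u, hu, hmax⟩ := (T.subtree w).toFinset.exists_max_image f
      ⟨w, (hmem w).2 (T.ancestor_refl w)⟩
    rw [Finset.card_eq_one]
    refine ⟨u, Finset.ext fun v => ?_⟩
    rw [Finset.mem_bipartiteAbove, Finset.mem_singleton]
    constructor
    · rintro ⟨hv, htop⟩
      exact f.injective (le_antisymm (hmax v hv) (htop u ((hmem u).1 hu)))
    · rintro rfl
      exact ⟨hu, fun x hx => hmax x ((hmem x).2 hx)⟩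
  · intro u hu
    replace hu : T.ancestor w u := (hmem u).1 hu
    refine Finset.card_nbij' (fun f => (Equiv.swap w u).trans f)
      (fun f => (Equiv.swap w u).trans f) ?_ ?_ ?_ ?_
    · intro f hf
      obtain ⟨hf, htop⟩ := (Finset.mem_bipartiteBelow _).1 hf
      refine mem_partialExts.2 ((Finset.forall_mem_insert _ _ _).2
        ⟨?_, mem_partialExts.1 (swap_trans_mem_partialExts hS hw hu hf)⟩)
      refine (isTop_comp_swap_iff hu).2 ?_
      rwa [Equiv.swap_apply_left]
    · intro f hf
      obtain ⟨htop, hf⟩ := (Finset.forall_mem_insert _ _ _).1 (mem_partialExts.1 hf)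
      refine (Finset.mem_bipartiteBelow _).2
        ⟨swap_trans_mem_partialExts hS hw hu (mem_partialExts.2 hf), ?_⟩
      refine (isTop_comp_swap_iff hu).2 ?_
      rwa [Equiv.swap_apply_right]
    · intro f _
      ext x
      simp
    · intro f _
      ext x
      simp

theorem card_partialExts_mul_prod [Fintype α] (S : Finset α) (hS : T.AncestorClosed S) :
    (T.partialExts S).card * ∏ v ∈ S, (T.subtree v).ncard = (Fintype.card α).factorial := by
  classical
  induction S using Finset.strongInduction with
  | H S ih =>
    rcases S.eq_empty_or_nonempty with rfl | hne
    · simp [partialExts, Fintype.card_equiv (Fintype.equivFin α)]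
    · obtain ⟨w, hw, hclosed⟩ := hS.exists_erase hne
      rw [← ih _ (Finset.erase_ssubset hw) hclosed,
        ← card_partialExts_insert hclosed (Finset.notMem_erase w S), Finset.insert_erase hw,
        ← Finset.mul_prod_erase S _ hw, mul_assoc]

theorem coe_partialExts_univ [Fintype α] :
    (T.partialExts Finset.univ : Set (α ≃ Fin (Fintype.card α))) = linExts T := by
  ext f
  rw [Finset.mem_coe, mem_partialExts]
  constructor
  · intro h u v huv
    exact lt_of_le_of_ne (h u (Finset.mem_univ u) v huv.1)
      fun heq => huv.2 (f.injective heq).symm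
  · intro h u _ v huv
    rcases eq_or_ne u v with rfl | hne
    · exact le_rfl
    · exact (h u v ⟨huv, hne⟩).le

end RTree

/-- Knuth's hook-length formula for trees:
`|LE(T)| · ∏_{v ∈ V(T)} |T_v| = n!`. -/
theorem knuth_hook_length {α : Type*} [Fintype α] (T : RTree α) :
    (linExts T).ncard * ∏ v : α, (T.subtree v).ncard = Nat.factorial (Fintype.card α) := by
  rw [← RTree.coe_partialExts_univ, Set.ncard_coe_finset]
  exact RTree.card_partialExts_mul_prod _ fun _ _ u _ => Finset.mem_univ u
end

section
/- Let T be a rooted tree with n ≥ 2 nodes and ℓ leaves, and let k be a positive integer. Then H_k(T) + n ≥ (1/3)·min{k, ℓ}·log₂ n. -/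
/-- For `S ⊆ V(T)`, `H_S(T) = Σ_{v ∈ S} log₂(|S| / |V(T_v) ∩ S|)`. -/
noncomputable def entS {α : Type*} (T : RTree α) (S : Finset α) : ℝ :=
  ∑ v ∈ S, Real.logb 2 ((S.card : ℝ) / ((T.subtree v ∩ ↑S).ncard : ℝ))

/-- For a positive integer `k`, `H_k(T) = max{ H_S(T) : S ⊆ V(T), |S| ≤ k }`. -/
noncomputable def entK {α : Type*} [Fintype α] (T : RTree α) (k : ℕ) : ℝ :=
  (Finset.filter (fun S => S.card ≤ k) (Finset.univ : Finset α).powerset).sup'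
    ⟨∅, by simp⟩ (entS T)

/-- `S` is closed under taking descendants in `T`. -/
def DescClosed {α : Type*} (T : RTree α) (S : Finset α) : Prop :=
  ∀ v ∈ S, ∀ u ∈ T.subtree v, u ∈ S

theorem RTree.IsLeaf.subtree_eq {α : Type*} {T : RTree α} {v : α} (hv : T.IsLeaf v) :
    T.subtree v = {v} := by
  ext u
  simp only [RTree.subtree, RTree.ancestor, Set.mem_ofPred_eq, Set.mem_singleton_iff]
  refine ⟨?_, fun h => ⟨0, h⟩⟩
  rintro ⟨j, hj⟩
  induction j with
  | zero => exact hj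
  | succ j ih =>
    rw [Function.iterate_succ_apply'] at hj
    exact ih (hv _ hj)

theorem entS_of_forall_isLeaf {α : Type*} (T : RTree α) (S : Finset α)
    (hS : ∀ v ∈ S, T.IsLeaf v) : entS T S = S.card * Real.logb 2 S.card := by
  unfold entS
  rw [Finset.sum_congr rfl (g := fun _ => Real.logb 2 S.card)]
  · simp
  · intro v hv
    have h : T.subtree v ∩ ↑S = {v} := by
      rw [(hS v hv).subtree_eq]
      exact Set.inter_eq_left.mpr (by simpa using hv)
    simp [h]

theorem Real.logb_two_le_self {y : ℝ} (hy : 0 < y) : Real.logb 2 y ≤ y := by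
  have hlog := Real.log_two_gt_d9
  have hlog' := Real.log_two_lt_d9
  have h := Real.log_le_sub_one_of_pos (half_pos hy)
  rw [Real.log_div hy.ne' two_ne_zero] at h
  rw [Real.logb, div_le_iff₀ (by linarith)]
  nlinarith

/-- The bound `m log₂ (x^(1/3) / m) ≤ x^(1/3) ≤ x`, rearranged. -/
theorem third_mul_mul_logb_le {m x : ℝ} (hm : 0 ≤ m) (hx : 1 ≤ x) :
    (1 / 3 : ℝ) * m * Real.logb 2 x ≤ m * Real.logb 2 m + x := by
  have hx0 : 0 < x := by linarith
  rcases hm.eq_or_lt with rfl | hm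
  · simpa using hx0.le
  have hc : (0 : ℝ) < x ^ (1 / 3 : ℝ) := Real.rpow_pos_of_pos hx0 _
  have hcx : x ^ (1 / 3 : ℝ) ≤ x := by
    simpa using Real.rpow_le_rpow_of_exponent_le hx (show (1 / 3 : ℝ) ≤ 1 by norm_num)
  have h := mul_le_mul_of_nonneg_left (Real.logb_two_le_self (div_pos hc hm)) hm.le
  rw [Real.logb_div hc.ne' hm.ne', Real.logb_rpow_eq_mul_logb_of_pos hx0,
    mul_div_cancel₀ _ hm.ne'] at h
  linarith

/-- For a rooted tree `T` with `n ≥ 2` nodes and `ℓ` leaves and a positive integer `k`,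
`H_k(T) + n ≥ (1/3)·min{k, ℓ}·log₂ n`. -/
theorem entK_lower_bound {α : Type*} [Fintype α] (T : RTree α)
    (hn : 2 ≤ Fintype.card α) (k : ℕ) (hk : 0 < k) :
    (1 / 3 : ℝ) * (min k ({v : α | T.IsLeaf v}.ncard) : ℝ) * Real.logb 2 (Fintype.card α : ℝ) ≤
      entK T k + (Fintype.card α : ℝ) := by
  classical
  set L : Finset α := Finset.univ.filter fun v => T.IsLeaf v with hL
  have hcard : {v : α | T.IsLeaf v}.ncard = L.card := by
    rw [← Set.ncard_coe_finset]
    simp [hL]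
  obtain ⟨S, hSL, hS⟩ := Finset.exists_subset_card_eq (min_le_right k L.card)
  have hent : entS T S ≤ entK T k :=
    Finset.le_sup' (entS T) (by simp [hS])
  rw [entS_of_forall_isLeaf T S fun v hv => by simpa [hL] using hSL hv] at hent
  have h := third_mul_mul_logb_le (Nat.cast_nonneg S.card)
    (show (1 : ℝ) ≤ Fintype.card α by exact_mod_cast one_le_two.trans hn)
  rw [hcard, ← Nat.cast_min, ← hS]
  linarith
end

section
/- Let T be a rooted tree and let k ≤ k' be positive integers with k' ≤ |V(T)|. Then (k/k')·H_{k'}(T) − k·log₂(k'/k) ≤ H_k(T) ≤ H_{k'}(T). -/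
/-- Some `k`-element subset of `s` has average at least that of `s`. -/
theorem Finset.exists_subset_card_eq_mul_sum_le {α : Type*} (f : α → ℝ) (s : Finset α) (k : ℕ)
    (hk : k ≤ s.card) :
    ∃ t ⊆ s, t.card = k ∧ (k : ℝ) * ∑ v ∈ s, f v ≤ (s.card : ℝ) * ∑ v ∈ t, f v := by
  classical
  induction s using Finset.strongInduction with
  | H s ih =>
    rcases hk.eq_or_lt with rfl | hlt
    · exact ⟨s, subset_rfl, rfl, le_rfl⟩
    rcases k.eq_zero_or_pos with rfl | hpos
    · exact ⟨∅, by simp, by simp, by simp⟩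
    obtain ⟨x, hx, hmin⟩ := s.exists_min_image f (Finset.card_pos.mp (by omega))
    have hcard := Finset.card_erase_add_one hx
    obtain ⟨t, hts, htk, ht⟩ := ih (s.erase x) (Finset.erase_ssubset hx) (by omega)
    refine ⟨t, hts.trans (Finset.erase_subset _ _), htk, ?_⟩
    have hsum := Finset.add_sum_erase s f hx
    have hle : ((s.erase x).card : ℝ) * f x ≤ ∑ v ∈ s.erase x, f v := by
      rw [← nsmul_eq_mul]
      exact Finset.card_nsmul_le_sum _ _ _ fun v hv => hmin v (Finset.mem_of_mem_erase hv)
    have hm : (0 : ℝ) < (s.erase x).card := by exact_mod_cast (by omega : 0 < (s.erase x).card)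
    rw [← hsum, ← hcard]
    push_cast
    refine le_of_mul_le_mul_left ?_ hm
    have h₁ := mul_le_mul_of_nonneg_left hle (Nat.cast_nonneg (α := ℝ) k)
    have h₂ := mul_le_mul_of_nonneg_left ht (by linarith : (0 : ℝ) ≤ (s.erase x).card + 1)
    linarith

theorem RTree.ncard_subtree_inter_pos {α : Type*} (T : RTree α) {S : Finset α} {v : α}
    (hv : v ∈ S) : 0 < (T.subtree v ∩ ↑S).ncard :=
  (Set.ncard_pos (S.finite_toSet.inter_of_right _)).2 ⟨v, ⟨0, rfl⟩, hv⟩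

theorem RTree.ncard_subtree_inter_mono {α : Type*} (T : RTree α) {S' S : Finset α} (h : S' ⊆ S)
    (v : α) : (T.subtree v ∩ ↑S').ncard ≤ (T.subtree v ∩ ↑S).ncard :=
  Set.ncard_le_ncard (Set.inter_subset_inter_right _ (Finset.coe_subset.2 h))
    (S.finite_toSet.inter_of_right _)

theorem entS_nonneg {α : Type*} (T : RTree α) (S : Finset α) : 0 ≤ entS T S := by
  refine Finset.sum_nonneg fun v hv => Real.logb_nonneg one_lt_two ?_
  have hpos := T.ncard_subtree_inter_pos hv
  rw [le_div_iff₀ (by exact_mod_cast hpos), one_mul]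
  have hle := Set.ncard_le_ncard (Set.inter_subset_right (s := T.subtree v) (t := ↑S))
    S.finite_toSet
  rw [Set.ncard_coe_finset] at hle
  exact_mod_cast hle

theorem entS_le_entK {α : Type*} [Fintype α] (T : RTree α) {S : Finset α} {k : ℕ}
    (hS : S.card ≤ k) : entS T S ≤ entK T k :=
  Finset.le_sup' (entS T) (by simpa using hS)

theorem exists_entK_eq_entS {α : Type*} [Fintype α] (T : RTree α) (k : ℕ) :
    ∃ S : Finset α, S.card ≤ k ∧ entK T k = entS T S := by
  obtain ⟨S, hS, h⟩ := Finset.exists_mem_eq_sup'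
    (s := Finset.filter (fun S => S.card ≤ k) (Finset.univ : Finset α).powerset)
    ⟨∅, by simp⟩ (entS T)
  exact ⟨S, (Finset.mem_filter.1 hS).2, h⟩

/-- Passing to a nonempty subset `S'` of `S` loses at most `log₂ (|S| / |S'|)` per node. -/
theorem sum_logb_sub_le_entS {α : Type*} (T : RTree α) {S' S : Finset α} (h : S' ⊆ S)
    (hne : S'.Nonempty) :
    ∑ v ∈ S', Real.logb 2 ((S.card : ℝ) / ((T.subtree v ∩ ↑S).ncard : ℝ)) -
      (S'.card : ℝ) * Real.logb 2 ((S.card : ℝ) / (S'.card : ℝ)) ≤ entS T S' := by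
  rw [entS, ← nsmul_eq_mul, ← Finset.sum_const, ← Finset.sum_sub_distrib]
  refine Finset.sum_le_sum fun v hv => ?_
  have hS' : (0 : ℝ) < S'.card := by exact_mod_cast hne.card_pos
  have hS : (0 : ℝ) < S.card := by exact_mod_cast (hne.mono h).card_pos
  have hn' : (0 : ℝ) < (T.subtree v ∩ ↑S').ncard := by
    exact_mod_cast T.ncard_subtree_inter_pos hv
  have hn : (0 : ℝ) < (T.subtree v ∩ ↑S).ncard := by
    exact_mod_cast T.ncard_subtree_inter_pos (h hv)
  rw [Real.logb_div hS.ne' hn.ne', Real.logb_div hS.ne' hS'.ne', Real.logb_div hS'.ne' hn'.ne']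
  have := Real.logb_le_logb_of_le one_lt_two hn'
    (Nat.cast_le.2 (T.ncard_subtree_inter_mono h v))
  linarith

/-- Monotonicity of `H_k(T)`: for positive integers `k ≤ k' ≤ |V(T)|`,
`(k/k')·H_{k'}(T) − k·log₂(k'/k) ≤ H_k(T) ≤ H_{k'}(T)`. -/
theorem entK_mono_bounds {α : Type*} [Fintype α] (T : RTree α) (k k' : ℕ)
    (hk : 0 < k) (hkk' : k ≤ k') (hk' : k' ≤ Fintype.card α) :
    ((k : ℝ) / (k' : ℝ)) * entK T k' - (k : ℝ) * Real.logb 2 ((k' : ℝ) / (k : ℝ)) ≤ entK T k ∧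
      entK T k ≤ entK T k' := by
  have hk0 : (0 : ℝ) < k := by exact_mod_cast hk
  have hk0' : (0 : ℝ) < k' := by exact_mod_cast hk.trans_le hkk'
  have hkk : (k : ℝ) ≤ k' := by exact_mod_cast hkk'
  constructor
  · obtain ⟨S, hS, hEq⟩ := exists_entK_eq_entS T k'
    rw [hEq]
    have hnn := entS_nonneg T S
    rcases le_or_gt S.card k with hle | hlt
    · have hlog := mul_nonneg hk0.le
        (Real.logb_nonneg one_lt_two ((one_le_div hk0).2 hkk))
      have hfrac := mul_le_of_le_one_left hnn ((div_le_one hk0').2 hkk)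
      linarith [entS_le_entK T hle]
    · obtain ⟨S', hsub, hcard, havg⟩ := Finset.exists_subset_card_eq_mul_sum_le
        (fun v => Real.logb 2 ((S.card : ℝ) / ((T.subtree v ∩ ↑S).ncard : ℝ))) S k hlt.le
      have hS0 : (0 : ℝ) < S.card := by exact_mod_cast hk.trans hlt
      have hSk' : (S.card : ℝ) ≤ k' := by exact_mod_cast hS
      have hent := sum_logb_sub_le_entS T hsub (Finset.card_pos.1 (hcard ▸ hk))
      rw [hcard] at hent
      have havg' : (k : ℝ) / S.card * entS T S ≤
          ∑ v ∈ S', Real.logb 2 ((S.card : ℝ) / ((T.subtree v ∩ ↑S).ncard : ℝ)) := by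
        rw [div_mul_eq_mul_div, div_le_iff₀' hS0]
        exact havg
      have hfrac : (k : ℝ) / k' * entS T S ≤ (k : ℝ) / S.card * entS T S := by gcongr
      have hlog : (k : ℝ) * Real.logb 2 ((S.card : ℝ) / k) ≤
          (k : ℝ) * Real.logb 2 ((k' : ℝ) / k) :=
        mul_le_mul_of_nonneg_left
          (Real.logb_le_logb_of_le one_lt_two (by positivity) (by gcongr)) hk0.le
      linarith [entS_le_entK T hcard.le]
  · obtain ⟨S, hS, hEq⟩ := exists_entK_eq_entS T k
    exact hEq ▸ entS_le_entK T (hS.trans hkk')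
end

section
/- Let G be a tree, let T be a rooting of G, and let p and p' be T-monotone priority functions for G that induce different ascending orders on V(G). Then Ind(G,p) ≠ Ind(G,p'). -/
/-- `T` is an elimination tree on the (connected) graph `G`: every subtree of `T` induces a
connected subgraph of `G`, and every edge of `G` joins an ancestor-descendant pair of `T`.
(For connected `G` this is equivalent to the recursive definition: some vertex `r` is the
root, and the child subtrees of `r` are elimination trees on the components of `G − r`.) -/
def IsElimTree {α : Type*} (G : SimpleGraph α) (T : RTree α) : Prop :=
  (∀ v : α, (G.induce (T.subtree v)).Connected) ∧
  (∀ u v : α, G.Adj u v → T.ancestor u v ∨ T.ancestor v u)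

/-- `T` is the Cartesian tree `Ind(G,p)`: the (unique) elimination tree on `G` in which
`p(u) < p(v)` whenever `u` is a proper ancestor of `v`. -/
def IsCartesianTree {α : Type*} (G : SimpleGraph α) (p : α → ℝ) (T : RTree α) : Prop :=
  IsElimTree G T ∧ ∀ u v : α, T.properAncestor u v → p u < p v

/-- `T` is a rooting of the tree `G`: the parent-child pairs of `T` are exactly the edges
of `G`. -/
def IsRooting {α : Type*} (G : SimpleGraph α) (T : RTree α) : Prop :=
  ∀ u v : α, G.Adj u v ↔ ((T.parent u = v ∧ u ≠ v) ∨ (T.parent v = u ∧ v ≠ u))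

/-- `p` is a `T`-monotone priority function: `p` is injective and `p(v) < p(u)` whenever
`u` is a proper ancestor of `v` in `T`. -/
def IsMonotonePriority {α : Type*} (T : RTree α) (p : α → ℝ) : Prop :=
  Function.Injective p ∧ ∀ u v : α, T.properAncestor u v → p v < p u

theorem RTree.ancestor_trans {α : Type*} (T : RTree α) {u v w : α}
    (huv : T.ancestor u v) (hvw : T.ancestor v w) : T.ancestor u w := by
  obtain ⟨k, rfl⟩ := huv
  obtain ⟨l, rfl⟩ := hvw
  exact ⟨k + l, Function.iterate_add_apply _ _ _ _⟩

/-- Two ancestors of the same node are comparable. -/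
theorem RTree.ancestor_or_ancestor {α : Type*} (T : RTree α) {u v w : α}
    (hu : T.ancestor u w) (hv : T.ancestor v w) : T.ancestor u v ∨ T.ancestor v u := by
  obtain ⟨k, rfl⟩ := hu
  obtain ⟨l, rfl⟩ := hv
  rcases le_total k l with h | h
  · exact .inr ⟨l - k, by rw [← Function.iterate_add_apply, Nat.sub_add_cancel h]⟩
  · exact .inl ⟨k - l, by rw [← Function.iterate_add_apply, Nat.sub_add_cancel h]⟩

theorem IsMonotonePriority.le_parent {α : Type*} {T : RTree α} {p : α → ℝ}
    (hp : IsMonotonePriority T p) (v : α) : p v ≤ p (T.parent v) := by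
  by_cases h : T.parent v = v
  · rw [h]
  · exact (hp.2 _ _ ⟨⟨1, rfl⟩, h⟩).le

/-- In a Cartesian tree, a descendant of `u` passes descent from `u` on to every neighbour
whose priority is at least that of `u`. -/
theorem IsCartesianTree.ancestor_of_adj {α : Type*} {G : SimpleGraph α} {p : α → ℝ}
    {S : RTree α} (hS : IsCartesianTree G p S) {u x y : α} (hxy : G.Adj x y)
    (hux : p u ≤ p x) (hy : S.ancestor u y) : S.ancestor u x := by
  rcases hS.1.2 x y hxy with h | h
  · rcases S.ancestor_or_ancestor hy h with h' | h'
    · exact h'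
    · by_cases hne : x = u
      · exact ⟨0, hne⟩
      · exact absurd (hS.2 x u ⟨h', hne⟩) (not_lt.mpr hux)
  · exact S.ancestor_trans hy h

/-- The Cartesian tree of a monotone priority function is a path ordered by priority. -/
theorem IsCartesianTree.ancestor_of_le {α : Type*} {G : SimpleGraph α} {p : α → ℝ}
    {S T : RTree α} (hS : IsCartesianTree G p S) (hT : IsRooting G T)
    (hp : IsMonotonePriority T p) {u v : α} (huv : p u ≤ p v) : S.ancestor u v := by
  have hup : ∀ k, p u ≤ p (T.parent^[k] u) ∧ S.ancestor u (T.parent^[k] u) := by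
    intro k
    induction k with
    | zero => exact ⟨le_rfl, 0, rfl⟩
    | succ k ih =>
      rw [Function.iterate_succ_apply']
      have hle := ih.1.trans (hp.le_parent _)
      refine ⟨hle, ?_⟩
      by_cases h : T.parent (T.parent^[k] u) = T.parent^[k] u
      · rw [h]
        exact ih.2
      · exact hS.ancestor_of_adj ((hT _ _).2 (.inr ⟨rfl, Ne.symm h⟩)) hle ih.2
  have hdown : ∀ k v, T.parent^[k] v = T.root → p u ≤ p v → S.ancestor u v := by
    intro k
    induction k with
    | zero =>
      intro v hv _
      obtain ⟨l, hl⟩ := T.reaches_root u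
      rw [show v = T.root from hv, ← hl]
      exact (hup l).2
    | succ k ih =>
      intro v hv hle
      have hpar := ih (T.parent v) hv (hle.trans (hp.le_parent v))
      by_cases h : T.parent v = v
      · rwa [h] at hpar
      · exact hS.ancestor_of_adj ((hT _ _).2 (.inl ⟨rfl, Ne.symm h⟩)) hle hpar
  obtain ⟨k, hk⟩ := T.reaches_root v
  exact hdown k v hk huv

theorem IsCartesianTree.properAncestor_iff {α : Type*} {G : SimpleGraph α} {p : α → ℝ}
    {S T : RTree α} (hS : IsCartesianTree G p S) (hT : IsRooting G T)
    (hp : IsMonotonePriority T p) (u v : α) : S.properAncestor u v ↔ p u < p v :=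
  ⟨hS.2 u v, fun h => ⟨hS.ancestor_of_le hT hp h.le, fun e => h.ne (congrArg p e)⟩⟩

/-- If `p` and `p'` are `T`-monotone priority functions for a rooting `T` of a tree `G`
that induce different ascending orders on `V(G)`, then `Ind(G,p) ≠ Ind(G,p')`. -/
theorem cartesianTree_ne_of_order_ne {α : Type*} [Fintype α]
    (G : SimpleGraph α) (hG : G.IsTree) (T : RTree α) (hT : IsRooting G T)
    (p p' : α → ℝ) (hp : IsMonotonePriority T p) (hp' : IsMonotonePriority T p')
    (hdiff : ¬ ∀ u v : α, p u < p v ↔ p' u < p' v)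
    (S S' : RTree α) (hS : IsCartesianTree G p S) (hS' : IsCartesianTree G p' S') :
    S ≠ S' := by
  rintro rfl
  exact hdiff fun u v =>
    (hS.properAncestor_iff hT hp u v).symm.trans (hS'.properAncestor_iff hT hp' u v)
end

section
/- Let G be a tree and let T be an arbitrary rooting of G. Then |ET(G)| ≥ |LE(T)|, i.e., the number of elimination trees on G is at least the number of linear extensions of the partial order with Hasse diagram T. -/
/-- The rooted path whose nodes, read from the root downwards, are in the order given by `f`. -/
def RTree.ofEquivFin {α : Type*} {n : ℕ} (hn : 0 < n) (f : α ≃ Fin n) : RTree α where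
  root := f.symm ⟨0, hn⟩
  parent v := f.symm ⟨(f v : ℕ) - 1, lt_of_le_of_lt (Nat.sub_le _ _) (f v).isLt⟩
  parent_root := by simp
  reaches_root := by
    suffices h : ∀ (k : ℕ) (v : α), (f v : ℕ) = k → ∃ j,
        (fun v => f.symm ⟨(f v : ℕ) - 1, lt_of_le_of_lt (Nat.sub_le _ _) (f v).isLt⟩)^[j] v =
          f.symm ⟨0, hn⟩ from fun v => h _ v rfl
    intro k
    induction k with
    | zero => exact fun v hv => ⟨0, by simp [Equiv.eq_symm_apply, Fin.ext_iff, hv]⟩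
    | succ k ih =>
      intro v hv
      obtain ⟨j, hj⟩ := ih (f.symm ⟨(f v : ℕ) - 1, by omega⟩) (by simp [hv])
      exact ⟨j + 1, hj⟩

lemma RTree.ofEquivFin_iterate_parent {α : Type*} {n : ℕ} (hn : 0 < n) (f : α ≃ Fin n)
    (k : ℕ) (v : α) : (f ((RTree.ofEquivFin hn f).parent^[k] v) : ℕ) = f v - k := by
  induction k with
  | zero => simp
  | succ k ih =>
    rw [Function.iterate_succ_apply', Nat.sub_succ, ← ih]
    simp [RTree.ofEquivFin]

lemma RTree.ofEquivFin_ancestor_iff {α : Type*} {n : ℕ} (hn : 0 < n) (f : α ≃ Fin n)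
    (u v : α) : (RTree.ofEquivFin hn f).ancestor u v ↔ f u ≤ f v := by
  constructor
  · rintro ⟨k, rfl⟩
    rw [Fin.le_def, RTree.ofEquivFin_iterate_parent]
    exact Nat.sub_le _ _
  · intro h
    rw [Fin.le_def] at h
    refine ⟨(f v : ℕ) - f u, f.injective (Fin.ext ?_)⟩
    rw [RTree.ofEquivFin_iterate_parent]
    omega

lemma RTree.ofEquivFin_injective {α : Type*} {n : ℕ} (hn : 0 < n) :
    Function.Injective (RTree.ofEquivFin (α := α) hn) := by
  intro f g h
  have hle (u v : α) : g u ≤ g v ↔ f u ≤ f v := by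
    rw [← RTree.ofEquivFin_ancestor_iff hn f, h, RTree.ofEquivFin_ancestor_iff]
  let e : Fin n ≃o Fin n := ⟨f.symm.trans g, by simp [hle]⟩
  ext v
  have := congrArg (fun e : Fin n ≃o Fin n => e (f v)) (Subsingleton.elim e (OrderIso.refl _))
  simp only [OrderIso.refl_apply] at this
  rw [← this]
  simp [e]

instance RTree.instFinite {α : Type*} [Finite α] : Finite (RTree α) :=
  Finite.of_injective (fun T : RTree α => (T.root, T.parent)) fun S T h => by
    cases S
    cases T
    simpa using h

/-- In a rooting of `G`, a nonempty set of nodes closed under `parent` is connected. -/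
lemma IsRooting.induce_connected {α : Type*} {G : SimpleGraph α} {T : RTree α}
    (hT : IsRooting G T) {s : Set α} (hs : s.Nonempty) (hp : ∀ v ∈ s, T.parent v ∈ s) :
    (G.induce s).Connected := by
  have hiter (k : ℕ) : ∀ v (hv : v ∈ s), ∃ h : T.parent^[k] v ∈ s,
      (G.induce s).Reachable ⟨v, hv⟩ ⟨_, h⟩ := by
    induction k with
    | zero => exact fun v hv => ⟨hv, .refl _⟩
    | succ k ih =>
      intro v hv
      obtain ⟨h, hr⟩ := ih _ (hp v hv)
      refine ⟨h, .trans ?_ hr⟩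
      by_cases hv' : v = T.parent v
      · have : (⟨v, hv⟩ : s) = ⟨T.parent v, hp v hv⟩ := Subtype.ext hv'
        rw [this]
      · exact SimpleGraph.Adj.reachable ((hT _ _).2 (.inl ⟨rfl, hv'⟩))
  have hroot : ∀ v (hv : v ∈ s), ∃ h : T.root ∈ s, (G.induce s).Reachable ⟨v, hv⟩ ⟨_, h⟩ := by
    intro v hv
    obtain ⟨k, hk⟩ := T.reaches_root v
    simpa only [hk] using hiter k v hv
  obtain ⟨w, hw⟩ := hs
  have : Nonempty s := ⟨⟨w, hw⟩⟩
  refine ⟨fun u v => ?_⟩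
  obtain ⟨_, hu⟩ := hroot u u.2
  obtain ⟨_, hv⟩ := hroot v v.2
  exact hu.trans hv.symm

lemma isElimTree_ofEquivFin {α : Type*} [Fintype α] {G : SimpleGraph α} {T : RTree α}
    (hT : IsRooting G T) (hn : 0 < Fintype.card α) {f : α ≃ Fin (Fintype.card α)}
    (hf : f ∈ linExts T) : IsElimTree G (RTree.ofEquivFin hn f) := by
  refine ⟨fun v => hT.induce_connected ⟨v, 0, rfl⟩ fun u hu => ?_, fun u v _ => ?_⟩
  · have hu' := (RTree.ofEquivFin_ancestor_iff hn f v u).1 hu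
    refine (RTree.ofEquivFin_ancestor_iff hn f v _).2 (hu'.trans ?_)
    by_cases h : T.parent u = u
    · rw [h]
    · exact (hf _ _ ⟨⟨1, rfl⟩, h⟩).le
  · simp only [RTree.ofEquivFin_ancestor_iff]
    exact le_total _ _

/-- If `G` is a tree and `T` an arbitrary rooting of `G`, then the number of elimination
trees on `G` is at least the number of linear extensions of the tree order of `T`. -/
theorem card_elimTrees_ge_card_linExts {α : Type*} [Fintype α]
    (G : SimpleGraph α) (hG : G.IsTree) (T : RTree α) (hT : IsRooting G T) :
    (linExts T).ncard ≤ {S : RTree α | IsElimTree G S}.ncard := by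
  have hn : 0 < Fintype.card α := Fintype.card_pos_iff.2 ⟨T.root⟩
  exact Set.ncard_le_ncard_of_injOn (RTree.ofEquivFin hn)
    (fun _ hf => isElimTree_ofEquivFin hT hn hf) (RTree.ofEquivFin_injective hn).injOn
    (Set.toFinite _)
end

section
/- Let G be a connected graph with an injective vertex priority function p : V(G) → ℝ. Let C be a cycle in G and let e be an edge of C incident to the minimum-priority vertex of C. Then for every pair of vertices u, v ∈ V(G), the value bottleneck(u,v) is the same in (G,p) and in (G − e, p). -/
/-- `bottleneck(u,v)` in `(G,p)`: the maximum, over all paths between `u` and `v` in `G`,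
of the minimum priority of a vertex on the path. -/
noncomputable def bottleneck {α : Type*} (G : SimpleGraph α) (p : α → ℝ) (u v : α) : ℝ :=
  sSup {b : ℝ | ∃ P : G.Walk u v, P.IsPath ∧ b = sInf (p '' {x | x ∈ P.support})}

/-- If every walk of `G` from `u` to `w` is dominated by a walk of `H` all of whose vertices have
priority at least that of some vertex of the original walk, then the bottleneck value in `G` is
at most that in `H`. -/
theorem bottleneck_le_of_walk_dominated {α : Type*} {G H : SimpleGraph α} {p : α → ℝ} {u w : α}
    (hr : G.Reachable u w)
    (h : ∀ P : G.Walk u w, ∃ Q : H.Walk u w, ∀ y ∈ Q.support, ∃ z ∈ P.support, p z ≤ p y) :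
    bottleneck G p u w ≤ bottleneck H p u w := by
  classical
  have bdd {K : SimpleGraph α} (P : K.Walk u w) : BddBelow (p '' {x | x ∈ P.support}) :=
    (P.support.finite_toSet.image p).bddBelow
  apply csSup_le
  · obtain ⟨P, hP⟩ := hr.exists_isPath
    exact ⟨_, P, hP, rfl⟩
  · rintro _ ⟨P, -, rfl⟩
    obtain ⟨Q, hQ⟩ := h P
    refine le_csSup_of_le ⟨p u, ?_⟩ ⟨Q.bypass, Q.bypass_isPath, rfl⟩ ?_
    · rintro _ ⟨R, -, rfl⟩
      exact csInf_le (bdd R) ⟨u, R.start_mem_support, rfl⟩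
    · refine le_csInf ⟨p u, u, Q.bypass.start_mem_support, rfl⟩ ?_
      rintro _ ⟨y, hy, rfl⟩
      obtain ⟨z, hz, hzy⟩ := hQ y (Q.support_bypass_subset_support hy)
      exact (csInf_le (bdd P) ⟨z, hz, rfl⟩).trans hzy

/-- The endpoints of an edge of a cycle are joined by a walk which avoids that edge and stays
on the vertices of the cycle. -/
theorem SimpleGraph.Walk.IsCycle.exists_walk_deleteEdges {α : Type*} {G : SimpleGraph α} {a : α}
    {C : G.Walk a a} (hC : C.IsCycle) {x y : α} (he : s(x, y) ∈ C.edges) :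
    ∃ Q : (G.deleteEdges {s(x, y)}).Walk x y, ∀ z ∈ Q.support, z ∈ C.support := by
  let K : SimpleGraph α := SimpleGraph.fromEdgeSet {f | f ∈ C.edges}
  have hK {b c : α} (h : K.Adj b c) : s(b, c) ∈ C.edges :=
    ((SimpleGraph.fromEdgeSet_adj _).1 h).1
  have hCK : ∀ f ∈ C.edges, f ∈ K.edgeSet := fun f hf => by
    rw [SimpleGraph.edgeSet_fromEdgeSet]
    exact ⟨hf, G.not_isDiag_of_mem_edgeSet (C.edges_subset_edgeSet hf)⟩
  obtain ⟨-, ⟨W⟩⟩ := SimpleGraph.adj_and_reachable_delete_edges_iff_exists_cycle.2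
    ⟨a, C.transfer K hCK, hC.transfer hCK, by rwa [C.edges_transfer]⟩
  have hle : K.deleteEdges {s(x, y)} ≤ G.deleteEdges {s(x, y)} :=
    SimpleGraph.deleteEdges_mono fun _ _ h => C.adj_of_mem_edges (hK h)
  have hW {b c : α} (W : (K.deleteEdges {s(x, y)}).Walk b c) (hc : c ∈ C.support) :
      ∀ z ∈ W.support, z ∈ C.support := by
    induction W with
    | nil => simpa using hc
    | cons h W ih =>
      intro z hz
      rcases List.mem_cons.1 (W.support_cons h ▸ hz) with rfl | hz
      · exact C.fst_mem_support_of_mem_edges (hK (SimpleGraph.deleteEdges_le _ h))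
      · exact ih hc z hz
  refine ⟨W.mapLe hle, fun z hz => hW W (C.snd_mem_support_of_mem_edges he) z ?_⟩
  simpa using hz

/-- Deleting an edge whose endpoints are joined in the remaining graph by a walk with priorities
at least that of one of the endpoints keeps every walk dominated. -/
theorem SimpleGraph.Walk.exists_dominating_deleteEdges {α : Type*} {G : SimpleGraph α}
    {p : α → ℝ} {x y : α} (Q : (G.deleteEdges {s(x, y)}).Walk x y)
    (hQ : ∀ z ∈ Q.support, p x ≤ p z) {u w : α} (P : G.Walk u w) :
    ∃ R : (G.deleteEdges {s(x, y)}).Walk u w, ∀ z ∈ R.support, ∃ t ∈ P.support, p t ≤ p z := by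
  induction P with
  | nil => exact ⟨.nil, fun z hz => ⟨z, by simpa using hz, le_rfl⟩⟩
  | @cons b c d h P ih =>
    obtain ⟨R, hR⟩ := ih
    have hR' : ∀ z ∈ R.support, ∃ t ∈ (SimpleGraph.Walk.cons h P).support, p t ≤ p z :=
      fun z hz => (hR z hz).imp fun t ht => ⟨by simp [ht.1], ht.2⟩
    by_cases hbc : s(b, c) = s(x, y)
    · rcases Sym2.eq_iff.1 hbc with ⟨rfl, rfl⟩ | ⟨rfl, rfl⟩
      · refine ⟨Q.append R, fun z hz => ?_⟩
        rcases (Q.mem_support_append_iff R).1 hz with hz | hz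
        · exact ⟨b, by simp, hQ z hz⟩
        · exact hR' z hz
      · refine ⟨Q.reverse.append R, fun z hz => ?_⟩
        rcases (Q.reverse.mem_support_append_iff R).1 hz with hz | hz
        · exact ⟨c, by simp, hQ z (by simpa using hz)⟩
        · exact hR' z hz
    · refine ⟨.cons (SimpleGraph.deleteEdges_adj.2 ⟨h, hbc⟩) R, fun z hz => ?_⟩
      rcases List.mem_cons.1 (R.support_cons _ ▸ hz) with rfl | hz
      · exact ⟨z, by simp, le_rfl⟩
      · exact hR' z hz

/-- Let `C` be a cycle in a connected graph `G` with injective vertex priorities `p`, and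
let `e` be an edge of `C` incident to the minimum-priority vertex of `C`. Then all
bottleneck values are the same in `(G,p)` and `(G − e, p)`. -/
theorem bottleneck_deleteEdge_of_cycle {α : Type*} [Fintype α]
    (G : SimpleGraph α) (hG : G.Connected) (p : α → ℝ) (hp : Function.Injective p)
    {a : α} (C : G.Walk a a) (hC : C.IsCycle)
    (v : α) (hv : v ∈ C.support) (hvmin : ∀ x ∈ C.support, p v ≤ p x)
    (e : Sym2 α) (he : e ∈ C.edges) (hve : v ∈ e) :
    ∀ u w : α, bottleneck G p u w = bottleneck (G.deleteEdges {e}) p u w := by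
  obtain ⟨x, rfl⟩ := hve
  obtain ⟨Q, hQ⟩ := hC.exists_walk_deleteEdges he
  have dom {u w : α} (P : G.Walk u w) :=
    SimpleGraph.Walk.exists_dominating_deleteEdges Q (fun z hz => hvmin z (hQ z hz)) P
  intro u w
  obtain ⟨P⟩ := hG u w
  refine le_antisymm (bottleneck_le_of_walk_dominated ⟨P⟩ dom)
    (bottleneck_le_of_walk_dominated ⟨(dom P).choose⟩ fun R => ?_)
  exact ⟨R.mapLe (SimpleGraph.deleteEdges_le _), fun z hz => ⟨z, by simpa using hz, le_rfl⟩⟩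
end

section
/- There is a universal constant c > 0 such that the following holds. Let n be a positive integer and let T be the heap-shaped (complete) binary tree on node set {1, …, n}, in which node i has left child 2i and right child 2i+1 whenever these are at most n. Let w : {1, …, n} → ℕ be a weight function with w(i) ≥ 1 for all i, and let W = Σ_{i=1}^n w(i). Then the potential Φ(T,w) = Σ_{v=1}^{n} log₂( Σ_{u ∈ T_v} w(u) ) satisfies Φ(T,w) ≤ c · W, where T_v denotes the set of nodes in the subtree rooted at v. -/
open Classical in
/-- In the heap-shaped binary tree, the labels of the ancestors of `u` (including `u` itself)
add up to at most `2 * u`. -/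
theorem sum_heap_ancestors_le (n u : ℕ) :
    ∑ v ∈ (Finset.Icc 1 n).filter (fun v => ∃ k : ℕ, u / 2 ^ k = v), v ≤ 2 * u := by
  induction u using Nat.strong_induction_on with
  | _ u ih =>
    rcases Nat.eq_zero_or_pos u with rfl | hu
    · refine (Finset.sum_eq_zero fun v hv => ?_).le
      obtain ⟨k, hk⟩ := (Finset.mem_filter.1 hv).2
      simpa using hk.symm
    · have hsub : (Finset.Icc 1 n).filter (fun v => ∃ k : ℕ, u / 2 ^ k = v) ⊆
          insert u ((Finset.Icc 1 n).filter (fun v => ∃ k : ℕ, u / 2 / 2 ^ k = v)) := by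
        intro v hv
        obtain ⟨hv, k, hk⟩ := Finset.mem_filter.1 hv
        cases k with
        | zero => exact Finset.mem_insert.2 (Or.inl (by simpa using hk.symm))
        | succ k =>
          refine Finset.mem_insert_of_mem (Finset.mem_filter.2 ⟨hv, k, ?_⟩)
          rw [Nat.div_div_eq_div_mul, ← pow_succ', hk]
      have hle := Finset.sum_le_sum_of_subset (f := fun v : ℕ => v) hsub
      have hins : ∑ v ∈ insert u ((Finset.Icc 1 n).filter (fun v => ∃ k : ℕ, u / 2 / 2 ^ k = v)), v
          ≤ u + ∑ v ∈ (Finset.Icc 1 n).filter (fun v => ∃ k : ℕ, u / 2 / 2 ^ k = v), v := by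
        rw [Finset.insert_eq]
        exact (Nat.le_add_right _ _).trans (Finset.sum_union_inter.trans (by simp)).le
      have := ih (u / 2) (by omega)
      omega

open Classical in
/-- The subtree weights of the heap-shaped binary tree on `{1, …, n}`, weighted by the labels of
their roots, add up to at most `2 * n` times the total weight. -/
theorem sum_mul_heap_subtree_weight_le (n : ℕ) (w : ℕ → ℕ) :
    ∑ v ∈ Finset.Icc 1 n,
        v * ∑ u ∈ (Finset.Icc 1 n).filter (fun u => ∃ k : ℕ, u / 2 ^ k = v), w u
      ≤ 2 * n * ∑ i ∈ Finset.Icc 1 n, w i := by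
  simp only [Finset.mul_sum, Finset.sum_filter]
  simp only [mul_ite, mul_zero]
  rw [Finset.sum_comm]
  refine Finset.sum_le_sum fun u hu => ?_
  rw [← Finset.sum_filter, ← Finset.sum_mul]
  have := sum_heap_ancestors_le n u
  have := (Finset.mem_Icc.1 hu).2
  exact Nat.mul_le_mul_right _ (by omega)

/-- A crude form of Stirling's lower bound: `n log n - log n! ≤ n`. -/
theorem sum_log_sub_log_le (n : ℕ) :
    ∑ v ∈ Finset.Icc 1 n, (Real.log n - Real.log v) ≤ n := by
  rcases Nat.eq_zero_or_pos n with rfl | hn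
  · simp
  have hprod : ∑ v ∈ Finset.Icc 1 n, Real.log v = Real.log (n.factorial : ℝ) := by
    rw [← Finset.prod_Ico_id_eq_factorial, Finset.Ico_add_one_right_eq_Icc, Nat.cast_prod, Real.log_prod]
    intro v hv
    have := (Finset.mem_Icc.1 hv).1
    positivity
  have hfac : (0 : ℝ) < n.factorial := by positivity
  have hpow : (0 : ℝ) < (n : ℝ) ^ n := by positivity
  have h := Real.log_le_log (by positivity)
    (Real.pow_div_factorial_le_exp (n : ℝ) (Nat.cast_nonneg n) n)
  rw [Real.log_exp, Real.log_div hpow.ne' hfac.ne', Real.log_pow] at h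
  rw [Finset.sum_sub_distrib, hprod]
  simpa using h

open Classical in
/-- There is a universal constant `c > 0` such that for the heap-shaped complete binary tree
on `{1, …, n}` (node `i` has children `2i` and `2i+1` when they are at most `n`; the subtree
of `v` consists of the `u` with `u / 2^k = v` for some `k`) and any weight function
`w : {1, …, n} → ℕ` with all weights at least `1`, the potential
`Φ(T,w) = Σ_{v=1}^n log₂(Σ_{u ∈ T_v} w(u))` is at most `c · W`, where `W = Σ_i w(i)`. -/
theorem potential_complete_binary_tree_le :
    ∃ c : ℝ, 0 < c ∧ ∀ n : ℕ, 1 ≤ n → ∀ w : ℕ → ℕ, (∀ i ∈ Finset.Icc 1 n, 1 ≤ w i) →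
      ∑ v ∈ Finset.Icc 1 n,
          Real.logb 2
            ((∑ u ∈ (Finset.Icc 1 n).filter (fun u => ∃ k : ℕ, u / 2 ^ k = v), w u : ℕ) : ℝ)
        ≤ c * ((∑ i ∈ Finset.Icc 1 n, w i : ℕ) : ℝ) := by
  have hlog2 : 0 < Real.log 2 := Real.log_pos one_lt_two
  refine ⟨3 / Real.log 2, by positivity, fun n hn w hw => ?_⟩
  have hn0 : (0 : ℝ) < n := by exact_mod_cast hn
  set S : ℕ → ℕ := fun v =>
    ∑ u ∈ (Finset.Icc 1 n).filter (fun u => ∃ k : ℕ, u / 2 ^ k = v), w u with hS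
  have hterm : ∀ v ∈ Finset.Icc 1 n,
      Real.log (S v : ℝ) ≤ (Real.log n - Real.log v) + (v * S v : ℕ) / (n : ℝ) := by
    intro v hv
    have hv0 : (0 : ℝ) < v := by exact_mod_cast (Finset.mem_Icc.1 hv).1
    have hSv : 1 ≤ S v := (hw v hv).trans <|
      Finset.single_le_sum (f := w) (fun _ _ => Nat.zero_le _)
        (Finset.mem_filter.2 ⟨hv, 0, by simp⟩)
    have hSv0 : (0 : ℝ) < S v := by exact_mod_cast hSv
    have h := Real.log_le_self (x := (v * S v : ℝ) / n) (by positivity)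
    rw [Real.log_div (by positivity) hn0.ne', Real.log_mul hv0.ne' hSv0.ne'] at h
    push_cast
    linarith
  have hcard : (n : ℝ) ≤ (∑ i ∈ Finset.Icc 1 n, w i : ℕ) := by
    have := Finset.card_nsmul_le_sum _ w 1 hw
    simp only [Nat.card_Icc, smul_eq_mul, mul_one, Nat.add_sub_cancel] at this
    exact_mod_cast this
  have hweight : (∑ v ∈ Finset.Icc 1 n, ((v * S v : ℕ) : ℝ)) / n
      ≤ 2 * (∑ i ∈ Finset.Icc 1 n, w i : ℕ) := by
    rw [div_le_iff₀ hn0, ← Nat.cast_sum]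
    have h : ((∑ v ∈ Finset.Icc 1 n, v * S v : ℕ) : ℝ)
        ≤ (2 * n * ∑ i ∈ Finset.Icc 1 n, w i : ℕ) :=
      Nat.cast_le.2 (sum_mul_heap_subtree_weight_le n w)
    rw [Nat.cast_mul, Nat.cast_mul, Nat.cast_ofNat] at h
    linarith
  have hsum := Finset.sum_le_sum hterm
  rw [Finset.sum_add_distrib, ← Finset.sum_div] at hsum
  have hstirling := sum_log_sub_log_le n
  simp only [Real.logb]
  rw [← Finset.sum_div, div_mul_eq_mul_div]
  exact div_le_div_of_nonneg_right (by linarith) hlog2.le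
end
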